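/- (Weighted Sobolev inequality) Fix t, a ∈ ℝ, δ ∈ (0,2/3) and ω = 1+δ. Let z be a smooth divergence-free vector field on ℝ³ such that ⟨u₊⟩^ω ∂^β z ∈ L²(ℝ³) for all multi-indices β with |β| ≤ 2. Then for every x ∈ ℝ³, |⟨u₊⟩^ω(t,x) z(x)|² ≤ C ( ‖⟨u₊⟩^ω z‖²_{L²(ℝ³)} + Σ_{|β| ≤ 1} ‖⟨u₊⟩^ω curl(∂^β z)‖²_{L²(ℝ³)} ), where C is a universal constant independent of a and t. The analogous statement holds with ⟨u₋⟩ in place of ⟨u₊⟩. -/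

import Mathlib

open MeasureTheory Real Set
open scoped ENNReal NNReal BigOperators Topology

noncomputable section

/-- Spatial slice `ℝ³`. -/
abbrev Sp : Type := EuclideanSpace ℝ (Fin 3)

/-- Build a point of `ℝ³` from its three coordinates. -/
def pt3 (a b c : ℝ) : Sp := (WithLp.equiv 2 (Fin 3 → ℝ)).symm ![a, b, c]

variable {F : Type*} [NormedAddCommGroup F] [NormedSpace ℝ F]

/-- Spatial partial derivative `∂ᵢ` for functions on `ℝ³`. -/
def pd (i : Fin 3) (f : Sp → F) : Sp → F :=
  fun x => fderiv ℝ f x (EuclideanSpace.single i 1)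

/-- Multi-index partial derivative `∂^β`. -/
def mpd (β : Fin 3 → ℕ) (f : Sp → F) : Sp → F :=
  (pd 0)^[β 0] ((pd 1)^[β 1] ((pd 2)^[β 2] f))

/-- The totally antisymmetric Levi-Civita symbol on `Fin 3`. -/
def lev (i j k : Fin 3) : ℝ :=
  if (i, j, k) = (0, 1, 2) ∨ (i, j, k) = (1, 2, 0) ∨ (i, j, k) = (2, 0, 1) then 1
  else if (i, j, k) = (0, 2, 1) ∨ (i, j, k) = (2, 1, 0) ∨ (i, j, k) = (1, 0, 2) then -1
  else 0

/-- curl of a vector field on `ℝ³`:  `(curl f)ₖ = ε_{ijk} ∂_i f^j`. -/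
def curl3 (v : Sp → Sp) : Sp → Sp :=
  fun x => (WithLp.equiv 2 (Fin 3 → ℝ)).symm
    (fun k => ∑ i, ∑ j, lev i j k * pd i (fun y => v y j) x)

/-- divergence of a vector field on `ℝ³`. -/
def div3 (v : Sp → Sp) : Sp → ℝ := fun x => ∑ i, pd i (fun y => v y i) x

/-- time derivative `∂_t` for functions on spacetime `ℝ × ℝ³`. -/
def pt (f : ℝ × Sp → F) : ℝ × Sp → F := fun q => deriv (fun s => f (s, q.2)) q.1

/-- spatial derivative `∂_{xᵢ}` for functions on spacetime. -/
def pX (i : Fin 3) (f : ℝ × Sp → F) : ℝ × Sp → F := fun q => pd i (fun y => f (q.1, y)) q.2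

/-- spatial gradient `∇p` of a scalar function on spacetime. -/
def grad3 (p : ℝ × Sp → ℝ) : ℝ × Sp → Sp :=
  fun q => (WithLp.equiv 2 (Fin 3 → ℝ)).symm (fun i => pX i p q)

/-- convection term `(z · ∇) w`. -/
def conv (z w : ℝ × Sp → Sp) : ℝ × Sp → Sp :=
  fun q => (WithLp.equiv 2 (Fin 3 → ℝ)).symm
    (fun k => ∑ i, z q i * pX i (fun r => w r k) q)

/-- The ideal incompressible MHD system in Elsässer variables on `ℝ_t × ℝ³_x`, with a
background magnetic field `B₀ = e₃`:
`∂_t z₊ − ∂_{x₃} z₊ = −∇p − (z₋·∇)z₊`, `∂_t z₋ + ∂_{x₃} z₋ = −∇p − (z₊·∇)z₋`,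
`div z₊ = div z₋ = 0`, the pressure being given by the Newtonian potential solving
`−Δp = ∂_i z₋^j ∂_j z₊^i`. -/
structure IsMHDSolution (zp zm : ℝ × Sp → Sp) (p : ℝ × Sp → ℝ) : Prop where
  smooth_zp : ContDiff ℝ (⊤ : ℕ∞) zp
  smooth_zm : ContDiff ℝ (⊤ : ℕ∞) zm
  smooth_p : ContDiff ℝ (⊤ : ℕ∞) p
  eq_zp : ∀ q : ℝ × Sp, pt zp q - pX 2 zp q = -(grad3 p q) - conv zm zp q
  eq_zm : ∀ q : ℝ × Sp, pt zm q + pX 2 zm q = -(grad3 p q) - conv zp zm q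
  div_zp : ∀ q : ℝ × Sp, div3 (fun y => zp (q.1, y)) q.2 = 0
  div_zm : ∀ q : ℝ × Sp, div3 (fun y => zm (q.1, y)) q.2 = 0
  newtonian : ∀ (t : ℝ) (x : Sp), p (t, x) =
    (1 / (4 * π)) * ∫ y : Sp, ‖x - y‖⁻¹ *
      ∑ i, ∑ j, pd i (fun u => zm (t, u) j) y * pd j (fun u => zp (t, u) i) y

/-- Weighted L² energy of the `k`-th derivatives on a time slice, with squared weight
`(1+|x₃ − b|²)^(1+δ)`. -/
def wSliceE (δ b : ℝ) (k : ℕ) (g : Sp → Sp) : ℝ≥0∞ :=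
  ∫⁻ x : Sp, ENNReal.ofReal ((1 + |x 2 - b| ^ 2) ^ (1 + δ) * ‖iteratedFDeriv ℝ k g x‖ ^ 2)

/-- `E^{(k)}_+(t)`-type energy for `z₊`, with weight `⟨u₋⟩^{2ω} = (1+|x₃+(t+a)|²)^{1+δ}`. -/
def energyP (δ a : ℝ) (k : ℕ) (f : ℝ × Sp → Sp) (t : ℝ) : ℝ≥0∞ :=
  wSliceE δ (-(t + a)) k (fun y => f (t, y))

/-- `E^{(k)}_-(t)`-type energy for `z₋`, with weight `⟨u₊⟩^{2ω} = (1+|x₃−(t+a)|²)^{1+δ}`. -/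
def energyM (δ a : ℝ) (k : ℕ) (f : ℝ × Sp → Sp) (t : ℝ) : ℝ≥0∞ :=
  wSliceE δ (t + a) k (fun y => f (t, y))

/-- Total initial weighted energy `𝓔^{N*}_+(0)` of `z₊`. -/
def EInitP (δ a : ℝ) (N : ℕ) (f : ℝ × Sp → Sp) : ℝ≥0∞ :=
  ∑ k ∈ Finset.range (N + 2), energyP δ a k f 0

/-- Total initial weighted energy `𝓔^{N*}_-(0)` of `z₋`. -/
def EInitM (δ a : ℝ) (N : ℕ) (f : ℝ × Sp → Sp) : ℝ≥0∞ :=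
  ∑ k ∈ Finset.range (N + 2), energyM δ a k f 0

/-- Total initial weighted energy `𝓔^{N*}(0)` expressed on initial data. -/
def EInit0 (δ a : ℝ) (N : ℕ) (zp0 zm0 : Sp → Sp) : ℝ≥0∞ :=
  ∑ k ∈ Finset.range (N + 2), (wSliceE δ (-a) k zp0 + wSliceE δ a k zm0)

/-- Flux of `g` through the characteristic hypersurface `C^{+,t}_{u₊} = {x₃ = u₊ + τ}`,
with weight `⟨u₋⟩^{2ω}` and surface measure `dσ₊ = √2 dx₁dx₂dτ`. -/
def fluxP (δ a : ℝ) (g : ℝ × Sp → Sp) (t u : ℝ) : ℝ≥0∞ :=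
  ∫⁻ τ in Icc (0 : ℝ) t, ∫⁻ y : ℝ × ℝ,
    ENNReal.ofReal (Real.sqrt 2 * (1 + |(u + τ) + (τ + a)| ^ 2) ^ (1 + δ) *
      ‖g (τ, pt3 y.1 y.2 (u + τ))‖ ^ 2)

/-- Flux of `g` through the characteristic hypersurface `C^{−,t}_{u₋} = {x₃ = u₋ − τ}`,
with weight `⟨u₊⟩^{2ω}` and surface measure `dσ₋ = √2 dx₁dx₂dτ`. -/
def fluxM (δ a : ℝ) (g : ℝ × Sp → Sp) (t u : ℝ) : ℝ≥0∞ :=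
  ∫⁻ τ in Icc (0 : ℝ) t, ∫⁻ y : ℝ × ℝ,
    ENNReal.ofReal (Real.sqrt 2 * (1 + |(u - τ) - (τ + a)| ^ 2) ^ (1 + δ) *
      ‖g (τ, pt3 y.1 y.2 (u - τ))‖ ^ 2)

/-- `j^{(α)} = curl ∂^α z` (spatial curl on each time slice). -/
def jA (α : Fin 3 → ℕ) (f : ℝ × Sp → Sp) : ℝ × Sp → Sp :=
  fun q => curl3 (mpd α (fun y => f (q.1, y))) q.2

/-- The nonlinearity `∇p + (z₋·∇)z₊` in the equation for `z₊`. -/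
def NLp (zp zm : ℝ × Sp → Sp) (p : ℝ × Sp → ℝ) : ℝ × Sp → Sp :=
  fun q => grad3 p q + conv zm zp q

/-- The nonlinearity `∇p + (z₊·∇)z₋` in the equation for `z₋`. -/
def NLm (zp zm : ℝ × Sp → Sp) (p : ℝ × Sp → ℝ) : ℝ × Sp → Sp :=
  fun q => grad3 p q + conv zp zm q

/-- Future scattering field of `z₊` on `𝓕₊`, in the coordinates `(x₁,x₂,u₋)`. -/
def scatPfut (zp zm : ℝ × Sp → Sp) (p : ℝ × Sp → ℝ) (x1 x2 u : ℝ) : Sp :=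
  zp (0, pt3 x1 x2 u) - ∫ τ in Ioi (0 : ℝ), NLp zp zm p (τ, pt3 x1 x2 (u - τ))

/-- Future scattering field of `z₋` on `𝓕₋`, in the coordinates `(x₁,x₂,u₊)`. -/
def scatMfut (zp zm : ℝ × Sp → Sp) (p : ℝ × Sp → ℝ) (x1 x2 u : ℝ) : Sp :=
  zm (0, pt3 x1 x2 u) - ∫ τ in Ioi (0 : ℝ), NLm zp zm p (τ, pt3 x1 x2 (u + τ))

/-- Past scattering field of `z₊` on `𝓟₊` (note `∫₀^{−∞} = −∫_{Iio 0}`). -/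
def scatPpast (zp zm : ℝ × Sp → Sp) (p : ℝ × Sp → ℝ) (x1 x2 u : ℝ) : Sp :=
  zp (0, pt3 x1 x2 u) + ∫ τ in Iio (0 : ℝ), NLp zp zm p (τ, pt3 x1 x2 (u - τ))

/-- Past scattering field of `z₋` on `𝓟₋`. -/
def scatMpast (zp zm : ℝ × Sp → Sp) (p : ℝ × Sp → ℝ) (x1 x2 u : ℝ) : Sp :=
  zm (0, pt3 x1 x2 u) + ∫ τ in Iio (0 : ℝ), NLm zp zm p (τ, pt3 x1 x2 (u + τ))

/-- The weight `⟨·⟩ = (1+|x₃−b|²)^{1/2}`. -/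
def wgt (b : ℝ) (x : Sp) : ℝ := Real.sqrt (1 + |x 2 - b| ^ 2)


open scoped FourierTransform SchwartzMap LineDeriv Laplacian

/-- The Laplacian of a function on `ℝ³`, as a sum of iterated partial derivatives. -/
def lap3 (f : Sp → F) : Sp → F := fun x => ∑ i, pd i (pd i f) x

theorem SchwartzMap.fourier_lineDerivOp_lineDerivOp_apply (f : 𝓢(Sp, ℂ)) (m ξ : Sp) :
    𝓕 (∂_{m} (∂_{m} f)) ξ = -((2 * π * inner ℝ ξ m) ^ 2 : ℝ) * 𝓕 f ξ := by
  have h : (inner ℝ · m).HasTemperateGrowth := ((innerSL ℝ).flip m).hasTemperateGrowth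
  rw [SchwartzMap.fourier_lineDerivOp_eq, SchwartzMap.fourier_lineDerivOp_eq]
  simp only [smul_apply, SchwartzMap.smulLeftCLM_apply_apply h, smul_eq_mul,
    Complex.real_smul]
  push_cast
  linear_combination (2 * π * (inner ℝ ξ m : ℂ)) ^ 2 * 𝓕 f ξ * Complex.I_sq

theorem SchwartzMap.norm_fourier_sub_laplacian_ge (f : 𝓢(Sp, ℂ)) (ξ : Sp) :
    (1 + ‖ξ‖ ^ 2) * ‖𝓕 f ξ‖ ≤
      ‖𝓕 (f - ∑ i, ∂_{EuclideanSpace.basisFun (Fin 3) ℝ i}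
        (∂_{EuclideanSpace.basisFun (Fin 3) ℝ i} f)) ξ‖ := by
  have h : 𝓕 (f - ∑ i, ∂_{EuclideanSpace.basisFun (Fin 3) ℝ i}
        (∂_{EuclideanSpace.basisFun (Fin 3) ℝ i} f)) ξ
      = ((1 + (2 * π) ^ 2 * ‖ξ‖ ^ 2 : ℝ) : ℂ) * 𝓕 f ξ := by
    have hs : 𝓕 (f - ∑ i, ∂_{EuclideanSpace.basisFun (Fin 3) ℝ i}
        (∂_{EuclideanSpace.basisFun (Fin 3) ℝ i} f))
        = 𝓕 f - ∑ i, 𝓕 (∂_{EuclideanSpace.basisFun (Fin 3) ℝ i}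
        (∂_{EuclideanSpace.basisFun (Fin 3) ℝ i} f)) := by
      simp only [← SchwartzMap.fourierTransformCLM_apply ℂ, map_sub, map_sum]
    rw [hs, sub_apply, sum_apply]
    have hi : ∀ i, inner ℝ ξ (EuclideanSpace.basisFun (Fin 3) ℝ i) = ξ i := fun i => by
      rw [real_inner_comm, EuclideanSpace.basisFun_inner]
    simp only [SchwartzMap.fourier_lineDerivOp_lineDerivOp_apply, EuclideanSpace.real_norm_sq_eq,
      Fin.sum_univ_three, hi]
    push_cast
    ring
  rw [h, norm_mul, Complex.norm_real, Real.norm_of_nonneg (by positivity)]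
  gcongr
  refine le_mul_of_one_le_left (by positivity) ?_
  nlinarith [Real.pi_gt_three]

theorem SchwartzMap.norm_apply_le_integral_fourier (f : 𝓢(Sp, ℂ)) (x : Sp) :
    ‖f x‖ ≤ ∫ ξ, ‖𝓕 f ξ‖ := by
  have h : f x = 𝓕⁻ (𝓕 f) x := by simp
  rw [h, SchwartzMap.fourierInv_coe, Real.fourierInv_eq]
  refine (norm_integral_le_integral_norm _).trans_eq ?_
  simp [Circle.norm_smul]

/-- The embedding `H² ↪ L^∞` in dimension three, for Schwartz functions. -/
theorem SchwartzMap.exists_norm_sq_le_integral_sub_laplacian :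
    ∃ C : ℝ, 0 ≤ C ∧ ∀ (f : 𝓢(Sp, ℂ)) (x : Sp), ‖f x‖ ^ 2 ≤
      C * ∫ y, ‖(f - ∑ i, ∂_{EuclideanSpace.basisFun (Fin 3) ℝ i}
        (∂_{EuclideanSpace.basisFun (Fin 3) ℝ i} f)) y‖ ^ 2 := by
  have hint : Integrable (fun ξ : Sp => ((1 + ‖ξ‖ ^ 2)⁻¹) ^ 2) := by
    have h := integrable_rpow_neg_one_add_norm_sq (E := Sp) (μ := volume) (r := 4)
      (by simp; norm_num)
    refine h.congr (Filter.Eventually.of_forall fun ξ => ?_)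
    have : (-4 / 2 : ℝ) = -((2 : ℕ) : ℝ) := by norm_num
    simp only [this]
    rw [Real.rpow_neg (by positivity), Real.rpow_natCast, inv_pow]
  refine ⟨∫ ξ : Sp, ((1 + ‖ξ‖ ^ 2)⁻¹) ^ 2, integral_nonneg fun _ => by positivity, fun f x => ?_⟩
  set g := f - ∑ i, ∂_{EuclideanSpace.basisFun (Fin 3) ℝ i}
        (∂_{EuclideanSpace.basisFun (Fin 3) ℝ i} f) with hg
  rw [← SchwartzMap.integral_norm_sq_fourier g]
  have hcs := integral_mul_le_Lp_mul_Lq_of_nonneg (μ := (volume : Measure Sp))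
    Real.HolderConjugate.two_two (f := fun ξ : Sp => (1 + ‖ξ‖ ^ 2)⁻¹) (g := fun ξ => ‖𝓕 g ξ‖)
    (Filter.Eventually.of_forall fun ξ => by simp only [Pi.zero_apply]; positivity)
    (Filter.Eventually.of_forall fun ξ => by simp)
    (by
      simp only [ENNReal.ofReal_ofNat]
      refine (memLp_two_iff_integrable_sq ?_).2 hint
      apply Measurable.aestronglyMeasurable (by fun_prop))
    (by
      simp only [ENNReal.ofReal_ofNat]
      exact ((𝓕 g).memLp 2).norm)
  have hle : ‖f x‖ ≤ ∫ ξ, (1 + ‖ξ‖ ^ 2)⁻¹ * ‖𝓕 g ξ‖ := by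
    refine (f.norm_apply_le_integral_fourier x).trans ?_
    refine integral_mono (𝓕 f).integrable.norm ?_ fun ξ => ?_
    · refine (𝓕 g).integrable.norm.mono' (by
        apply Continuous.aestronglyMeasurable
        exact Continuous.mul (Continuous.inv₀ (by fun_prop) fun ξ => by positivity)
          (𝓕 g).continuous.norm) (Filter.Eventually.of_forall fun ξ => ?_)
      rw [Real.norm_of_nonneg (by positivity)]
      refine mul_le_of_le_one_left (norm_nonneg _) (inv_le_one_of_one_le₀ ?_)
      nlinarith [sq_nonneg ‖ξ‖]
    · simp only
      rw [inv_mul_eq_div, le_div_iff₀ (by positivity), mul_comm]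
      exact f.norm_fourier_sub_laplacian_ge ξ
  have h := pow_le_pow_left₀ (norm_nonneg _) (hle.trans hcs) 2
  simp only [Real.rpow_two, ← Real.sqrt_eq_rpow, mul_pow] at h
  rwa [Real.sq_sqrt (integral_nonneg fun _ => by positivity),
    Real.sq_sqrt (integral_nonneg fun _ => by positivity)] at h

theorem ContDiff.pd {f : Sp → F} (hf : ContDiff ℝ (⊤ : ℕ∞) f) (i : Fin 3) :
    ContDiff ℝ (⊤ : ℕ∞) (pd i f) :=
  (hf.fderiv_right (m := (⊤ : ℕ∞)) (by simp)).clm_apply contDiff_const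

theorem ContDiff.lap3 {f : Sp → F} (hf : ContDiff ℝ (⊤ : ℕ∞) f) :
    ContDiff ℝ (⊤ : ℕ∞) (lap3 f) :=
  ContDiff.sum fun i _ => (hf.pd i).pd i

theorem pd_clm_comp {G : Type*} [NormedAddCommGroup G] [NormedSpace ℝ G] (L : F →L[ℝ] G)
    {f : Sp → F} (hf : ContDiff ℝ (⊤ : ℕ∞) f) (i : Fin 3) :
    pd i (fun y => L (f y)) = fun y => L (pd i f y) := by
  ext y
  have h : HasFDerivAt (fun y => L (f y)) (L.comp (fderiv ℝ f y)) y :=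
    L.hasFDerivAt.comp y (hf.differentiable (by simp) y).hasFDerivAt
  simp [pd, h.fderiv]

theorem exists_sq_le_integral_sub_lap3 :
    ∃ C : ℝ, 0 ≤ C ∧ ∀ g : Sp → ℝ, ContDiff ℝ (⊤ : ℕ∞) g → HasCompactSupport g → ∀ x,
      g x ^ 2 ≤ C * ∫ y, (g y - lap3 g y) ^ 2 := by
  obtain ⟨C, hC, h⟩ := SchwartzMap.exists_norm_sq_le_integral_sub_laplacian
  refine ⟨C, hC, fun g hg hgc x => ?_⟩
  have hc : HasCompactSupport (fun y => (g y : ℂ)) := hgc.comp_left (g := ((↑) : ℝ → ℂ)) rfl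
  have hs : ContDiff ℝ (⊤ : ℕ∞) (fun y => (g y : ℂ)) := Complex.ofRealCLM.contDiff.comp hg
  have hl : ∀ y, lap3 (fun y => (g y : ℂ)) y = (lap3 g y : ℝ) := by
    intro y
    have h1 : ∀ i, pd i (fun y => (g y : ℂ)) = fun y => ((pd i g y : ℝ) : ℂ) :=
      pd_clm_comp Complex.ofRealCLM hg
    have h2 : ∀ i, pd i (fun y => ((pd i g y : ℝ) : ℂ)) = fun y => ((pd i (pd i g) y : ℝ) : ℂ) :=
      fun i => pd_clm_comp Complex.ofRealCLM (hg.pd i) i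
    simp only [lap3, h1, h2, Complex.ofReal_sum]
  have hS : ∀ y, (hc.toSchwartzMap hs - ∑ i, ∂_{EuclideanSpace.basisFun (Fin 3) ℝ i}
        (∂_{EuclideanSpace.basisFun (Fin 3) ℝ i} (hc.toSchwartzMap hs))) y
      = ((g y - lap3 g y : ℝ) : ℂ) := by
    intro y
    rw [sub_apply, sum_apply, Complex.ofReal_sub, ← hl]
    congr 1
    refine Finset.sum_congr rfl fun i _ => ?_
    rw [SchwartzMap.lineDerivOp_apply_eq_fderiv]
    have h1 : ((∂_{EuclideanSpace.basisFun (Fin 3) ℝ i} (hc.toSchwartzMap hs) : 𝓢(Sp, ℂ)) : Sp → ℂ)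
        = pd i (fun y => (g y : ℂ)) := by
      ext y
      rw [SchwartzMap.lineDerivOp_apply_eq_fderiv, EuclideanSpace.basisFun_apply]
      rfl
    rw [h1, EuclideanSpace.basisFun_apply]
    rfl
  have h2 := h (hc.toSchwartzMap hs) x
  simpa only [hS, Complex.norm_real, Real.norm_eq_abs, sq_abs,
    HasCompactSupport.toSchwartzMap_toFun] using h2

theorem pd_comm {f : Sp → F} (hf : ContDiff ℝ (⊤ : ℕ∞) f) (i j : Fin 3) :
    pd i (pd j f) = pd j (pd i f) := by
  ext x
  have hs : ∀ v w : Sp, fderiv ℝ (fun y => fderiv ℝ f y v) x w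
      = fderiv ℝ (fderiv ℝ f) x w v := by
    intro v w
    have hd : DifferentiableAt ℝ (fderiv ℝ f) x :=
      (hf.fderiv_right (m := (⊤ : ℕ∞)) (by simp)).differentiable (by simp) x
    rw [fderiv_clm_apply hd (differentiableAt_const v)]
    simp
  change fderiv ℝ (fun y => fderiv ℝ f y _) x _ = fderiv ℝ (fun y => fderiv ℝ f y _) x _
  rw [hs, hs]
  exact (hf.contDiffAt.isSymmSndFDerivAt (by
    rw [minSmoothness_of_isRCLikeNormedField]
    exact WithTop.coe_le_coe.2 (le_top : (2 : ℕ∞) ≤ ⊤))) _ _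

theorem pd_mul {f g : Sp → ℝ} (hf : ContDiff ℝ (⊤ : ℕ∞) f) (hg : ContDiff ℝ (⊤ : ℕ∞) g)
    (i : Fin 3) : pd i (fun y => f y * g y) = fun y => pd i f y * g y + f y * pd i g y := by
  ext y
  simp only [pd]
  rw [fderiv_fun_mul (hf.differentiable (by simp) y) (hg.differentiable (by simp) y)]
  simp
  ring

theorem pd_add {f g : Sp → F} (hf : ContDiff ℝ (⊤ : ℕ∞) f) (hg : ContDiff ℝ (⊤ : ℕ∞) g)
    (i : Fin 3) : pd i (fun y => f y + g y) = fun y => pd i f y + pd i g y := by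
  ext y
  simp only [pd]
  rw [fderiv_fun_add (hf.differentiable (by simp) y) (hg.differentiable (by simp) y)]
  simp

theorem HasCompactSupport.pd {f : Sp → F} (hf : HasCompactSupport f) (i : Fin 3) :
    HasCompactSupport (pd i f) :=
  hf.fderiv_apply ℝ _

theorem HasCompactSupport.lap3 {f : Sp → F} (hf : HasCompactSupport f) :
    HasCompactSupport (lap3 f) := by
  have h : _root_.lap3 f = fun x => _root_.pd 0 (_root_.pd 0 f) x + _root_.pd 1 (_root_.pd 1 f) x
      + _root_.pd 2 (_root_.pd 2 f) x := by
    ext x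
    simp [_root_.lap3, Fin.sum_univ_three]
  rw [h]
  exact (((hf.pd 0).pd 0).add ((hf.pd 1).pd 1)).add ((hf.pd 2).pd 2)

theorem pd_eq_zero_of_notMem_tsupport {f : Sp → F} {x : Sp} (hx : x ∉ tsupport f) (i : Fin 3) :
    pd i f x = 0 := by
  rw [pd, fderiv_of_notMem_tsupport ℝ hx]
  rfl

theorem integral_pd_eq_zero {f : Sp → ℝ} (hf : ContDiff ℝ (⊤ : ℕ∞) f) (hc : HasCompactSupport f)
    (i : Fin 3) : ∫ y, pd i f y = 0 := by
  have h := integral_mul_fderiv_eq_neg_fderiv_mul_of_integrable (μ := (volume : Measure Sp))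
    (f := fun _ : Sp => (1 : ℝ)) (g := f) (v := EuclideanSpace.single i 1)
    (by simp)
    (by
      simp only [one_mul]
      exact (hf.pd i).continuous.integrable_of_hasCompactSupport (hc.pd i))
    (by simpa using hf.continuous.integrable_of_hasCompactSupport hc)
    (fun x _ => differentiableAt_const _) (fun x _ => hf.differentiable (by simp) x)
  simpa [pd] using h

theorem pd_comp_sub (f : Sp → F) (x : Sp) (i : Fin 3) :
    pd i (fun y => f (y - x)) = fun y => pd i f (y - x) := by
  ext y
  simp only [pd]
  rw [fderiv_comp_sub]

theorem exists_uniform_cutoff : ∃ B : ℝ, 0 ≤ B ∧ ∀ x : Sp, ∃ η : Sp → ℝ,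
    ContDiff ℝ (⊤ : ℕ∞) η ∧ HasCompactSupport η ∧ tsupport η ⊆ Metric.closedBall x 1 ∧ η x = 1 ∧
    (∀ y, |η y| ≤ 1) ∧ (∀ i y, |pd i η y| ≤ B) ∧ ∀ y, |lap3 η y| ≤ B := by
  let χ : ContDiffBump (0 : Sp) := ⟨1 / 2, 1, by norm_num, by norm_num⟩
  have hχ : ContDiff ℝ (⊤ : ℕ∞) χ := χ.contDiff
  have hχc : HasCompactSupport χ := χ.hasCompactSupport
  have hb : ∀ f : Sp → ℝ, Continuous f → HasCompactSupport f → ∃ B, ∀ y, |f y| ≤ B := by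
    intro f hf hfc
    obtain ⟨B, hB⟩ := hf.bounded_above_of_compact_support hfc
    exact ⟨B, hB⟩
  choose Bp hBp using fun i => hb _ (hχ.pd i).continuous (hχc.pd i)
  obtain ⟨Bl, hBl⟩ := hb _ hχ.lap3.continuous hχc.lap3
  have hBp0 : ∀ i, 0 ≤ Bp i := fun i => (abs_nonneg _).trans (hBp i 0)
  have hBl0 : 0 ≤ Bl := (abs_nonneg _).trans (hBl 0)
  refine ⟨∑ i, Bp i + Bl, add_nonneg (Finset.sum_nonneg fun i _ => hBp0 i) hBl0, fun x => ?_⟩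
  have hsupp : tsupport (fun y => χ (y - x)) ⊆ Metric.closedBall x 1 := by
    refine closure_minimal (fun y hy => ?_) Metric.isClosed_closedBall
    have hy' : y - x ∈ Function.support χ := hy
    rw [χ.support_eq] at hy'
    have h1 : ‖y - x‖ < 1 := by simpa [χ] using hy'
    simpa [dist_eq_norm] using h1.le
  refine ⟨fun y => χ (y - x), hχ.comp (contDiff_id.sub contDiff_const),
    HasCompactSupport.of_support_subset_isCompact (isCompact_closedBall x 1)
      ((subset_tsupport _).trans hsupp), hsupp, ?_, fun y => ?_, fun i y => ?_, fun y => ?_⟩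
  · simp only [sub_self]
    exact χ.one_of_mem_closedBall (Metric.mem_closedBall_self (by norm_num [χ]))
  · rw [abs_of_nonneg χ.nonneg]
    exact χ.le_one
  · rw [pd_comp_sub]
    have := Finset.single_le_sum (fun i _ => hBp0 i) (Finset.mem_univ i)
    linarith [hBp i (y - x)]
  · have h : lap3 (fun y => χ (y - x)) y = lap3 χ (y - x) := by
      simp only [lap3, pd_comp_sub]
    rw [h]
    have := Finset.sum_nonneg fun i (_ : i ∈ Finset.univ) => hBp0 i
    linarith [hBl (y - x)]

theorem pd_sq_mul {η u : Sp → ℝ} (hη : ContDiff ℝ (⊤ : ℕ∞) η) (hu : ContDiff ℝ (⊤ : ℕ∞) u)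
    (i : Fin 3) : pd i (fun y => η y * η y * u y)
      = fun y => 2 * (η y * pd i η y * u y) + η y * η y * pd i u y := by
  rw [pd_mul (hη.mul hη) hu, pd_mul hη hη]
  ext y
  ring

theorem lap3_sq_mul {η u : Sp → ℝ} (hη : ContDiff ℝ (⊤ : ℕ∞) η) (hu : ContDiff ℝ (⊤ : ℕ∞) u)
    (y : Sp) : lap3 (fun y => η y * η y * u y) y
      = η y ^ 2 * lap3 u y + 4 * η y * ∑ i, pd i η y * pd i u y
        + u y * (2 * ∑ i, pd i η y ^ 2 + 2 * η y * lap3 η y) := by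
  have h : ∀ i, pd i (pd i (fun y => η y * η y * u y)) y
      = η y ^ 2 * pd i (pd i u) y + 4 * η y * (pd i η y * pd i u y)
        + u y * (2 * pd i η y ^ 2 + 2 * η y * pd i (pd i η) y) := by
    intro i
    have h1 : (fun y => 2 * (η y * pd i η y * u y) + η y * η y * pd i u y)
        = fun y => (η y * pd i η y * u y + η y * pd i η y * u y) + η y * η y * pd i u y := by
      ext y
      ring
    have hs := (hη.mul (hη.pd i)).mul hu
    rw [pd_sq_mul hη hu, h1, pd_add (hs.add hs) ((hη.mul hη).mul (hu.pd i)), pd_add hs hs,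
      pd_mul (hη.mul (hη.pd i)) hu, pd_mul hη (hη.pd i), pd_sq_mul hη (hu.pd i)]
    ring
  simp only [lap3, h, Fin.sum_univ_three]
  ring

theorem sum_pd_caccioppoli {η u : Sp → ℝ} (hη : ContDiff ℝ (⊤ : ℕ∞) η)
    (hu : ContDiff ℝ (⊤ : ℕ∞) u) (y : Sp) :
    ∑ i, pd i (fun y => η y * η y * (u y * pd i u y)) y
      = 2 * η y * u y * (∑ i, pd i η y * pd i u y) + η y ^ 2 * (∑ i, pd i u y ^ 2)
        + η y ^ 2 * u y * lap3 u y := by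
  simp only [pd_sq_mul hη (hu.mul (hu.pd _)), pd_mul hu (hu.pd _), lap3, Fin.sum_univ_three]
  ring

/-- Pointwise algebra behind the local elliptic estimate: `e` and `l` are the values of a cutoff
and its Laplacian, `v` and `L` those of the function, `p` and `q` the two gradients. -/
theorem cutoff_laplacian_sq_le {B e l v L p₀ p₁ p₂ q₀ q₁ q₂ : ℝ} (he : |e| ≤ 1)
    (hl : |l| ≤ B) (h₀ : |p₀| ≤ B) (h₁ : |p₁| ≤ B) (h₂ : |p₂| ≤ B) :
    (e * e * v - (e ^ 2 * L + 4 * e * (p₀ * q₀ + p₁ * q₁ + p₂ * q₂)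
        + v * (2 * (p₀ ^ 2 + p₁ ^ 2 + p₂ ^ 2) + 2 * e * l))) ^ 2
      ≤ (4 + 4 * (6 * B ^ 2 + 2 * B) ^ 2 + 192 * B ^ 2 * (1 + 12 * B ^ 2)) * (v ^ 2 + L ^ 2)
        + 384 * B ^ 2 * (2 * e * v * (p₀ * q₀ + p₁ * q₁ + p₂ * q₂)
          + e ^ 2 * (q₀ ^ 2 + q₁ ^ 2 + q₂ ^ 2) + e ^ 2 * v * L) := by
  have hp₀ : p₀ ^ 2 ≤ B ^ 2 := sq_le_sq' (abs_le.1 h₀).1 (abs_le.1 h₀).2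
  have hp₁ : p₁ ^ 2 ≤ B ^ 2 := sq_le_sq' (abs_le.1 h₁).1 (abs_le.1 h₁).2
  have hp₂ : p₂ ^ 2 ≤ B ^ 2 := sq_le_sq' (abs_le.1 h₂).1 (abs_le.1 h₂).2
  have he2 : e ^ 2 ≤ 1 := by simpa using sq_le_sq' (abs_le.1 he).1 (abs_le.1 he).2
  set N := p₀ ^ 2 + p₁ ^ 2 + p₂ ^ 2 with hN
  set G := q₀ ^ 2 + q₁ ^ 2 + q₂ ^ 2 with hG
  set P := p₀ * q₀ + p₁ * q₁ + p₂ * q₂ with hP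
  have hN0 : 0 ≤ N := by positivity
  have hG0 : 0 ≤ G := by positivity
  have hNB : N ≤ 3 * B ^ 2 := by linarith
  have hPNG : P ^ 2 ≤ N * G := by
    have : N * G - P ^ 2 = (p₀ * q₁ - p₁ * q₀) ^ 2 + (p₀ * q₂ - p₂ * q₀) ^ 2
        + (p₁ * q₂ - p₂ * q₁) ^ 2 := by
      rw [hN, hG, hP]
      ring
    have : 0 ≤ N * G - P ^ 2 := by rw [this]; positivity
    linarith
  have hPG : P ^ 2 ≤ 3 * B ^ 2 * G := hPNG.trans (by gcongr)
  have hgrad : e ^ 2 * G ≤ 2 * (2 * e * v * P + e ^ 2 * G + e ^ 2 * v * L)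
      + (1 + 12 * B ^ 2) * (v ^ 2 + L ^ 2) := by
    have hcross : -(e ^ 2 * G + 4 * v ^ 2 * N) ≤ 4 * e * v * P := by
      have : e ^ 2 * G + 4 * v ^ 2 * N + 4 * e * v * P
          = (e * q₀ + 2 * v * p₀) ^ 2 + (e * q₁ + 2 * v * p₁) ^ 2 + (e * q₂ + 2 * v * p₂) ^ 2 := by
        rw [hN, hG, hP]
        ring
      have : 0 ≤ e ^ 2 * G + 4 * v ^ 2 * N + 4 * e * v * P := by rw [this]; positivity
      linarith
    have hvL : -(v ^ 2 + L ^ 2) ≤ 2 * e ^ 2 * v * L := by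
      have h1 : 0 ≤ e ^ 2 * (v + L) ^ 2 := by positivity
      have h2 : 0 ≤ (1 - e ^ 2) * (v ^ 2 + L ^ 2) := mul_nonneg (by linarith) (by positivity)
      linarith
    have hvN : 4 * v ^ 2 * N ≤ 12 * B ^ 2 * v ^ 2 := by
      have := mul_le_mul_of_nonneg_left hNB (by positivity : 0 ≤ 4 * v ^ 2)
      linarith
    have : 0 ≤ 12 * B ^ 2 * L ^ 2 := by positivity
    linarith
  have hM : (2 * N + 2 * e * l) ^ 2 ≤ (6 * B ^ 2 + 2 * B) ^ 2 := by
    have hel : |e * l| ≤ B := by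
      rw [abs_mul]
      simpa using mul_le_mul he hl (abs_nonneg _) zero_le_one
    refine sq_le_sq' ?_ ?_ <;> nlinarith [abs_le.1 hel]
  set M := 2 * N + 2 * e * l with hMdef
  have he4 : (e ^ 2) ^ 2 ≤ 1 := pow_le_one₀ (by positivity) he2
  have hsq : (e * e * v - (e ^ 2 * L + 4 * e * P + v * M)) ^ 2
      ≤ 4 * ((e ^ 2) ^ 2 * v ^ 2 + (e ^ 2) ^ 2 * L ^ 2 + 16 * (e ^ 2 * P ^ 2) + v ^ 2 * M ^ 2) := by
    have hquad : ∀ a b c d : ℝ,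
        (a - (b + c + d)) ^ 2 ≤ 4 * (a ^ 2 + b ^ 2 + c ^ 2 + d ^ 2) := fun a b c d => by
      linarith [sq_nonneg (a + b), sq_nonneg (a + c), sq_nonneg (a + d), sq_nonneg (b - c),
        sq_nonneg (b - d), sq_nonneg (c - d)]
    exact (hquad _ _ _ _).trans_eq (by ring)
  have t1 : (e ^ 2) ^ 2 * v ^ 2 ≤ 1 * v ^ 2 := by gcongr
  have t2 : (e ^ 2) ^ 2 * L ^ 2 ≤ 1 * L ^ 2 := by gcongr
  have t3 : e ^ 2 * P ^ 2 ≤ e ^ 2 * (3 * B ^ 2 * G) := by gcongr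
  have t4 : v ^ 2 * M ^ 2 ≤ v ^ 2 * (6 * B ^ 2 + 2 * B) ^ 2 := by gcongr
  have t5 := mul_le_mul_of_nonneg_left hgrad (by positivity : 0 ≤ 192 * B ^ 2)
  have t6 : 0 ≤ (6 * B ^ 2 + 2 * B) ^ 2 * L ^ 2 := by positivity
  linarith

/-- Interior estimate: a function is controlled at the centre of a unit ball by the `L²` norms of
itself and of its Laplacian over that ball. -/
theorem exists_sq_le_setIntegral_lap3 : ∃ C : ℝ, 0 ≤ C ∧ ∀ u : Sp → ℝ, ContDiff ℝ (⊤ : ℕ∞) u →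
    ∀ x, u x ^ 2 ≤ C * ∫ y in Metric.closedBall x 1, (u y ^ 2 + lap3 u y ^ 2) := by
  obtain ⟨C, hC, hsob⟩ := exists_sq_le_integral_sub_lap3
  obtain ⟨B, hB, hcut⟩ := exists_uniform_cutoff
  set K := 4 + 4 * (6 * B ^ 2 + 2 * B) ^ 2 + 192 * B ^ 2 * (1 + 12 * B ^ 2) with hK
  refine ⟨C * K, by positivity, fun u hu x => ?_⟩
  obtain ⟨η, hη, hηc, hηs, hηx, hη1, hηp, hηl⟩ := hcut x
  have hg : ContDiff ℝ (⊤ : ℕ∞) (fun y => η y * η y * u y) := (hη.mul hη).mul hu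
  have hgc : HasCompactSupport (fun y => η y * η y * u y) := (hηc.mul_left (f := η)).mul_right
  have hV : ∀ i, ContDiff ℝ (⊤ : ℕ∞) (fun y => η y * η y * (u y * pd i u y)) :=
    fun i => (hη.mul hη).mul (hu.mul (hu.pd i))
  have hVc : ∀ i, HasCompactSupport (fun y => η y * η y * (u y * pd i u y)) :=
    fun i => (hηc.mul_left (f := η)).mul_right
  have hVint : ∀ i, Integrable (pd i (fun y => η y * η y * (u y * pd i u y))) := fun i =>
    ((hV i).pd i).continuous.integrable_of_hasCompactSupport ((hVc i).pd i)
  set D : Sp → ℝ := fun y => ∑ i, pd i (fun y => η y * η y * (u y * pd i u y)) y with hD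
  have hDint : Integrable D := integrable_finsetSum _ fun i _ => hVint i
  have hD0 : ∫ y, D y = 0 := by
    rw [hD, integral_finsetSum _ fun i _ => hVint i]
    exact Finset.sum_eq_zero fun i _ => integral_pd_eq_zero (hV i) (hVc i) i
  have hEint : Integrable (Set.indicator (Metric.closedBall x 1)
      fun y => u y ^ 2 + lap3 u y ^ 2) := by
    rw [integrable_indicator_iff Metric.isClosed_closedBall.measurableSet]
    exact ((hu.continuous.pow 2).add (hu.lap3.continuous.pow 2)).continuousOn.integrableOn_compact
      (isCompact_closedBall x 1)
  have hpt : ∀ y, (η y * η y * u y - lap3 (fun y => η y * η y * u y) y) ^ 2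
      ≤ K * Set.indicator (Metric.closedBall x 1) (fun y => u y ^ 2 + lap3 u y ^ 2) y
        + 384 * B ^ 2 * D y := by
    intro y
    rw [lap3_sq_mul hη hu, hD]
    simp only [sum_pd_caccioppoli hη hu]
    by_cases hy : y ∈ Metric.closedBall x 1
    · rw [Set.indicator_of_mem hy]
      simp only [Fin.sum_univ_three]
      exact cutoff_laplacian_sq_le (hη1 y) (hηl y) (hηp 0 y) (hηp 1 y) (hηp 2 y)
    · have hy' : y ∉ tsupport η := fun h => hy (hηs h)
      rw [Set.indicator_of_notMem hy]
      simp [image_eq_zero_of_notMem_tsupport hy', pd_eq_zero_of_notMem_tsupport hy']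
  have hint : ∫ y, (η y * η y * u y - lap3 (fun y => η y * η y * u y) y) ^ 2
      ≤ K * ∫ y in Metric.closedBall x 1, (u y ^ 2 + lap3 u y ^ 2) := by
    refine (integral_mono ?_ ((hEint.const_mul K).add (hDint.const_mul (384 * B ^ 2))) hpt).trans_eq
      ?_
    · refine Continuous.integrable_of_hasCompactSupport
        ((hg.continuous.sub hg.lap3.continuous).pow 2) ?_
      exact (hgc.sub hgc.lap3).comp_left (g := fun r : ℝ => r ^ 2) (by simp)
    · rw [integral_add' (hEint.const_mul K) (hDint.const_mul _), integral_const_mul,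
        integral_const_mul, hD0, integral_indicator Metric.isClosed_closedBall.measurableSet]
      simp
  have := hsob _ hg hgc x
  simp only [hηx, one_mul] at this
  rw [mul_assoc]
  exact this.trans (by gcongr)

theorem pd_component {z : Sp → Sp} (hz : ContDiff ℝ (⊤ : ℕ∞) z) (i k : Fin 3) :
    (fun y => pd i z y k) = pd i (fun y => z y k) :=
  (pd_clm_comp (EuclideanSpace.proj (𝕜 := ℝ) k) hz i).symm

theorem ContDiff.component {z : Sp → Sp} (hz : ContDiff ℝ (⊤ : ℕ∞) z) (k : Fin 3) :
    ContDiff ℝ (⊤ : ℕ∞) (fun y => z y k) :=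
  (EuclideanSpace.proj (𝕜 := ℝ) k).contDiff.comp hz

theorem curl3_apply_zero (v : Sp → Sp) (y : Sp) :
    curl3 v y 0 = pd 1 (fun y => v y 2) y - pd 2 (fun y => v y 1) y := by
  simp [curl3, lev, Fin.sum_univ_three]
  ring

theorem curl3_apply_one (v : Sp → Sp) (y : Sp) :
    curl3 v y 1 = pd 2 (fun y => v y 0) y - pd 0 (fun y => v y 2) y := by
  simp [curl3, lev, Fin.sum_univ_three]
  ring

theorem curl3_apply_two (v : Sp → Sp) (y : Sp) :
    curl3 v y 2 = pd 0 (fun y => v y 1) y - pd 1 (fun y => v y 0) y := by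
  simp [curl3, lev, Fin.sum_univ_three]
  ring

theorem ContDiff.curl3 {v : Sp → Sp} (hv : ContDiff ℝ (⊤ : ℕ∞) v) :
    ContDiff ℝ (⊤ : ℕ∞) (curl3 v) := by
  rw [contDiff_euclidean]
  intro k
  have h : ∀ i j, ContDiff ℝ (⊤ : ℕ∞) (_root_.pd i (fun y => v y j)) :=
    fun i j => (hv.component j).pd i
  fin_cases k
  · exact (funext (curl3_apply_zero v)) ▸ (h 1 2).sub (h 2 1)
  · exact (funext (curl3_apply_one v)) ▸ (h 2 0).sub (h 0 2)
  · exact (funext (curl3_apply_two v)) ▸ (h 0 1).sub (h 1 0)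

theorem norm_curl3_sq_le {v : Sp → Sp} (hv : ContDiff ℝ (⊤ : ℕ∞) v) (y : Sp) :
    ‖curl3 v y‖ ^ 2 ≤ 2 * ∑ i, ‖pd i v y‖ ^ 2 := by
  simp only [EuclideanSpace.real_norm_sq_eq, Fin.sum_univ_three, curl3_apply_zero,
    curl3_apply_one, curl3_apply_two, ← pd_component hv]
  have h : ∀ a b : ℝ, (a - b) ^ 2 ≤ 2 * (a ^ 2 + b ^ 2) := fun a b => by
    linarith [sq_nonneg (a + b)]
  linarith [h (pd 1 v y 2) (pd 2 v y 1), h (pd 2 v y 0) (pd 0 v y 2), h (pd 0 v y 1) (pd 1 v y 0),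
    sq_nonneg (pd 0 v y 0), sq_nonneg (pd 1 v y 1), sq_nonneg (pd 2 v y 2)]

/-- For a divergence-free field the Laplacian is minus the curl of the curl. -/
theorem lap3_component_sq_le {z : Sp → Sp} (hz : ContDiff ℝ (⊤ : ℕ∞) z)
    (hdiv : ∀ x, div3 z x = 0) (k : Fin 3) (y : Sp) :
    lap3 (fun y => z y k) y ^ 2 ≤ 2 * ∑ i, ‖curl3 (pd i z) y‖ ^ 2 := by
  have hd : ∀ m, pd m (pd 0 (fun y => z y 0)) y + pd m (pd 1 (fun y => z y 1)) y
      + pd m (pd 2 (fun y => z y 2)) y = 0 := by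
    intro m
    have h0 : (fun x => pd 0 (fun y => z y 0) x + pd 1 (fun y => z y 1) x
        + pd 2 (fun y => z y 2) x) = fun _ => (0 : ℝ) := by
      ext x
      simpa [div3, Fin.sum_univ_three] using hdiv x
    have h1 := congrFun (congrArg (pd m) h0) y
    have hs : ∀ i, ContDiff ℝ (⊤ : ℕ∞) (pd i (fun y => z y i)) := fun i => (hz.component i).pd i
    rw [pd_add ((hs 0).add (hs 1)) (hs 2), pd_add (hs 0) (hs 1)] at h1
    simpa [pd] using h1
  have h01 : ∀ j, pd 1 (pd 0 (fun y => z y j)) = pd 0 (pd 1 (fun y => z y j)) :=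
    fun j => pd_comm (hz.component j) 1 0
  have h02 : ∀ j, pd 2 (pd 0 (fun y => z y j)) = pd 0 (pd 2 (fun y => z y j)) :=
    fun j => pd_comm (hz.component j) 2 0
  have h12 : ∀ j, pd 2 (pd 1 (fun y => z y j)) = pd 1 (pd 2 (fun y => z y j)) :=
    fun j => pd_comm (hz.component j) 2 1
  have hd0 := hd 0
  have hd1 := hd 1
  have hd2 := hd 2
  rw [h01] at hd1
  rw [h02, h12] at hd2
  have hsub : ∀ a b L S : ℝ, L = a - b → a ^ 2 + b ^ 2 ≤ S → L ^ 2 ≤ 2 * S := by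
    rintro a b L S rfl h
    linarith [sq_nonneg (a + b)]
  have hbound : ∀ i j k l, i ≠ k → curl3 (pd i z) y j ^ 2 + curl3 (pd k z) y l ^ 2
      ≤ ∑ i, ‖curl3 (pd i z) y‖ ^ 2 := by
    intro i j k l hik
    have hc : ∀ i j, curl3 (pd i z) y j ^ 2 ≤ ‖curl3 (pd i z) y‖ ^ 2 := fun i j => by
      rw [EuclideanSpace.real_norm_sq_eq]
      exact Finset.single_le_sum (f := fun j => curl3 (pd i z) y j ^ 2)
        (fun _ _ => sq_nonneg _) (Finset.mem_univ j)
    refine (add_le_add (hc i j) (hc k l)).trans ?_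
    rw [← Finset.sum_pair (f := fun i => ‖curl3 (pd i z) y‖ ^ 2) hik]
    exact Finset.sum_le_univ_sum_of_nonneg fun _ => by positivity
  fin_cases k
  · refine hsub _ _ _ _ ?_ (hbound 2 1 1 2 (by decide))
    simp only [lap3, Fin.sum_univ_three, curl3_apply_one, curl3_apply_two, pd_component hz]
    simp only [Fin.zero_eta]
    linarith
  · refine hsub _ _ _ _ ?_ (hbound 0 2 2 0 (by decide))
    simp only [lap3, Fin.sum_univ_three, curl3_apply_zero, curl3_apply_two, pd_component hz, h01]
    simp only [Fin.mk_one]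
    linarith
  · refine hsub _ _ _ _ ?_ (hbound 1 0 0 1 (by decide))
    simp only [lap3, Fin.sum_univ_three, curl3_apply_zero, curl3_apply_one, pd_component hz, h02,
      h12]
    simp only [Fin.reduceFinMk]
    linarith

theorem one_le_wgt (b : ℝ) (x : Sp) : 1 ≤ wgt b x :=
  Real.one_le_sqrt.2 (by nlinarith [sq_nonneg |x 2 - b|])

theorem continuous_wgt_rpow (b p : ℝ) : Continuous fun x : Sp => wgt b x ^ p := by
  refine Continuous.rpow_const ?_ fun x => Or.inl (zero_lt_one.trans_le (one_le_wgt b x)).ne'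
  unfold wgt
  fun_prop

theorem wgt_le_two_mul_wgt (b : ℝ) {x y : Sp} (h : y ∈ Metric.closedBall x 1) :
    wgt b x ≤ 2 * wgt b y := by
  have h1 : |y 2 - x 2| ≤ 1 := by
    have h2 := PiLp.norm_apply_le (y - x) 2
    rw [← dist_eq_norm] at h2
    exact h2.trans h
  unfold wgt
  rw [show (2 : ℝ) = Real.sqrt 4 by rw [show (4 : ℝ) = 2 ^ 2 by norm_num]; simp,
    ← Real.sqrt_mul (by norm_num)]
  refine Real.sqrt_le_sqrt ?_
  rw [sq_abs, sq_abs]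
  have h3 : (y 2 - x 2) ^ 2 ≤ 1 := by simpa using sq_le_sq' (abs_le.1 h1).1 (abs_le.1 h1).2
  nlinarith [sq_nonneg ((y 2 - b) + (y 2 - x 2)), sq_nonneg (y 2 - b)]

theorem integrable_wgt_mul_norm_curl3_pd_sq {δ b : ℝ} {z : Sp → Sp}
    (hz : ContDiff ℝ (⊤ : ℕ∞) z)
    (hint : ∀ β : Fin 3 → ℕ, (∑ i, β i) ≤ 2 →
      Integrable (fun x : Sp => wgt b x ^ (2 * (1 + δ)) * ‖mpd β z x‖ ^ 2)) (m : Fin 3) :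
    Integrable (fun x : Sp => wgt b x ^ (2 * (1 + δ)) * ‖curl3 (pd m z) x‖ ^ 2) := by
  have hpd : ∀ i, Integrable (fun x : Sp => wgt b x ^ (2 * (1 + δ)) * ‖pd i (pd m z) x‖ ^ 2) := by
    intro i
    wlog hle : i ≤ m generalizing i m
    · rw [pd_comm hz]
      exact this i m (le_of_not_ge hle)
    have hβ : pd i (pd m z) = mpd (Pi.single i 1 + Pi.single m 1) z := by
      fin_cases i <;> fin_cases m <;> first | rfl | (exact absurd hle (by decide))
    rw [hβ]
    refine hint _ ?_
    simp [Finset.sum_add_distrib]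
  refine (((integrable_finsetSum Finset.univ fun i _ => hpd i).const_mul 2)).mono'
    ((continuous_wgt_rpow b _).mul ((hz.pd m).curl3.continuous.norm.pow 2)).aestronglyMeasurable
    (Filter.Eventually.of_forall fun x => ?_)
  have hw : 0 ≤ wgt b x ^ (2 * (1 + δ)) :=
    Real.rpow_nonneg (zero_le_one.trans (one_le_wgt b x)) _
  rw [Real.norm_of_nonneg (by positivity), ← Finset.mul_sum, mul_left_comm]
  exact mul_le_mul_of_nonneg_left (norm_curl3_sq_le (hz.pd m) x) hw

/-- **Weighted Sobolev inequality.**  Fix `δ ∈ (0,2/3)` and `ω = 1+δ`.  For a smooth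
divergence-free vector field `z` on `ℝ³` with `⟨u₊⟩^ω ∂^β z ∈ L²` for all `|β| ≤ 2`, one has
the pointwise bound
`|⟨u₊⟩^ω(t,x) z(x)|² ≤ C (‖⟨u₊⟩^ω z‖²_{L²} + Σ_{|β|≤1} ‖⟨u₊⟩^ω curl ∂^β z‖²_{L²})`,
with `C` universal, independent of `a` and `t`.  The analogous statement with `⟨u₋⟩` also
holds; both are covered by taking `s = 1` (for `⟨u₊⟩ = wgt (s*(t+a))`) and `s = −1`
(for `⟨u₋⟩`). -/
theorem weighted_sobolev_inequality (δ : ℝ) (hδ : δ ∈ Set.Ioo (0 : ℝ) (2 / 3)) :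
    ∃ C : ℝ, 0 < C ∧
      ∀ s : ℝ, s = 1 ∨ s = -1 →
      ∀ (t a : ℝ) (z : Sp → Sp), ContDiff ℝ (⊤ : ℕ∞) z → (∀ x, div3 z x = 0) →
        (∀ β : Fin 3 → ℕ, (∑ i, β i) ≤ 2 →
          Integrable (fun x : Sp => (wgt (s * (t + a)) x) ^ (2 * (1 + δ)) * ‖mpd β z x‖ ^ 2)) →
        ∀ x : Sp,
          ((wgt (s * (t + a)) x) ^ (1 + δ) * ‖z x‖) ^ 2
            ≤ C * ((∫ y : Sp, (wgt (s * (t + a)) y) ^ (2 * (1 + δ)) * ‖z y‖ ^ 2)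
                + ∑ k ∈ Finset.range 2, ∑ β ∈ Finset.Nat.antidiagonalTuple 3 k,
                    ∫ y : Sp, (wgt (s * (t + a)) y) ^ (2 * (1 + δ)) * ‖curl3 (mpd β z) y‖ ^ 2) := by
  obtain ⟨hδ0, -⟩ := hδ
  obtain ⟨C, hC, hloc⟩ := exists_sq_le_setIntegral_lap3
  set K : ℝ := 2 ^ (2 * (1 + δ)) with hK
  have hK0 : 0 ≤ K := by positivity
  refine ⟨6 * (C * K) + 1, by positivity, fun s _ t a z hz hdiv hint x => ?_⟩
  set b := s * (t + a)
  set W : Sp → ℝ := fun y => wgt b y ^ (2 * (1 + δ)) with hW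
  have hWnn : ∀ y, 0 ≤ W y := fun y => Real.rpow_nonneg (zero_le_one.trans (one_le_wgt b y)) _
  have hWx : ∀ y ∈ Metric.closedBall x 1, W x ≤ K * W y := by
    intro y hy
    rw [hK, hW]
    simp only
    rw [← Real.mul_rpow zero_le_two (zero_le_one.trans (one_le_wgt b y))]
    exact Real.rpow_le_rpow (zero_le_one.trans (one_le_wgt b x)) (wgt_le_two_mul_wgt b hy)
      (by linarith)
  have hI0 : Integrable (fun y => W y * ‖z y‖ ^ 2) := hint 0 (by simp)
  have hIc : ∀ i, Integrable (fun y => W y * ‖curl3 (pd i z) y‖ ^ 2) :=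
    integrable_wgt_mul_norm_curl3_pd_sq hz hint
  set T := (∫ y, W y * ‖z y‖ ^ 2) + 2 * ∑ i, ∫ y, W y * ‖curl3 (pd i z) y‖ ^ 2 with hT
  have hcomp : ∀ k, W x * z x k ^ 2 ≤ C * K * T := by
    intro k
    have hu := hz.component k
    have hFint : Integrable
        (fun y => K * (W y * ‖z y‖ ^ 2 + 2 * ∑ i, W y * ‖curl3 (pd i z) y‖ ^ 2)) :=
      (hI0.add ((integrable_finsetSum Finset.univ fun i _ => hIc i).const_mul 2)).const_mul K
    have hball : W x * ∫ y in Metric.closedBall x 1, (z y k ^ 2 + lap3 (fun y => z y k) y ^ 2)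
        ≤ K * T := by
      have hTi : K * T = ∫ y, K * (W y * ‖z y‖ ^ 2 + 2 * ∑ i, W y * ‖curl3 (pd i z) y‖ ^ 2) := by
        rw [hT, integral_const_mul, integral_add hI0
          ((integrable_finsetSum Finset.univ fun i _ => hIc i).const_mul 2), integral_const_mul,
          integral_finsetSum _ fun i _ => hIc i]
      rw [hTi, ← integral_const_mul]
      refine (setIntegral_mono_on ?_ hFint.integrableOn
        Metric.isClosed_closedBall.measurableSet fun y hy => ?_).trans
        (setIntegral_le_integral hFint (Filter.Eventually.of_forall fun y => ?_))
      · exact (continuous_const.mul ((hu.continuous.pow 2).add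
          (hu.lap3.continuous.pow 2))).continuousOn.integrableOn_compact (isCompact_closedBall x 1)
      · have hzk : z y k ^ 2 ≤ ‖z y‖ ^ 2 := by
          rw [EuclideanSpace.real_norm_sq_eq]
          exact Finset.single_le_sum (f := fun j => z y j ^ 2)
            (fun _ _ => sq_nonneg _) (Finset.mem_univ k)
        calc W x * (z y k ^ 2 + lap3 (fun y => z y k) y ^ 2)
            ≤ (K * W y) * (‖z y‖ ^ 2 + 2 * ∑ i, ‖curl3 (pd i z) y‖ ^ 2) :=
              mul_le_mul (hWx y hy) (add_le_add hzk (lap3_component_sq_le hz hdiv k y))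
                (by positivity) (mul_nonneg hK0 (hWnn y))
          _ = _ := by
              rw [← Finset.mul_sum]
              ring
      · have := hWnn y
        simp only [Pi.zero_apply]
        exact mul_nonneg hK0 (add_nonneg (by positivity)
          (mul_nonneg zero_le_two (Finset.sum_nonneg fun i _ => by positivity)))
    calc W x * z x k ^ 2
        ≤ W x * (C * ∫ y in Metric.closedBall x 1, (z y k ^ 2 + lap3 (fun y => z y k) y ^ 2)) :=
          mul_le_mul_of_nonneg_left (hloc _ hu x) (hWnn x)
      _ = C * (W x * ∫ y in Metric.closedBall x 1,
            (z y k ^ 2 + lap3 (fun y => z y k) y ^ 2)) := by ring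
      _ ≤ C * (K * T) := mul_le_mul_of_nonneg_left hball hC
      _ = C * K * T := by ring
  have hlhs : (wgt b x ^ (1 + δ) * ‖z x‖) ^ 2 = ∑ k, W x * z x k ^ 2 := by
    have hsq : W x = (wgt b x ^ (1 + δ)) ^ 2 := by
      rw [← Real.rpow_mul_natCast (zero_le_one.trans (one_le_wgt b x)), mul_comm]
      rfl
    rw [mul_pow, EuclideanSpace.real_norm_sq_eq, Finset.mul_sum, hsq]
  have hInn : ∀ v : Sp → Sp, 0 ≤ ∫ y, W y * ‖v y‖ ^ 2 := fun v =>
    integral_nonneg fun y => mul_nonneg (hWnn y) (sq_nonneg _)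
  have hrhs : ∑ k ∈ Finset.range 2, ∑ β ∈ Finset.Nat.antidiagonalTuple 3 k,
      ∫ y, W y * ‖curl3 (mpd β z) y‖ ^ 2
      = (∫ y, W y * ‖curl3 z y‖ ^ 2) + ∑ i, ∫ y, W y * ‖curl3 (pd i z) y‖ ^ 2 := by
    have h0 : Finset.Nat.antidiagonalTuple 3 0 = {![0, 0, 0]} := by decide
    have h1 : Finset.Nat.antidiagonalTuple 3 1 = {![1, 0, 0], ![0, 1, 0], ![0, 0, 1]} := by decide
    rw [Finset.sum_range_succ, Finset.sum_range_one, h0, h1, Finset.sum_singleton,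
      Finset.sum_insert (by decide), Finset.sum_insert (by decide), Finset.sum_singleton,
      Fin.sum_univ_three, add_assoc (∫ y, W y * ‖curl3 (pd 0 z) y‖ ^ 2)]
    rfl
  rw [hlhs]
  change _ ≤ (6 * (C * K) + 1) * ((∫ y, W y * ‖z y‖ ^ 2)
    + ∑ k ∈ Finset.range 2, ∑ β ∈ Finset.Nat.antidiagonalTuple 3 k,
      ∫ y, W y * ‖curl3 (mpd β z) y‖ ^ 2)
  rw [hrhs]
  have hS : 0 ≤ ∑ i, ∫ y, W y * ‖curl3 (pd i z) y‖ ^ 2 := Finset.sum_nonneg fun i _ => hInn _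
  have hJ := hInn (curl3 z)
  have hZ := hInn z
  have hCK : 0 ≤ C * K := mul_nonneg hC hK0
  calc ∑ k, W x * z x k ^ 2 ≤ ∑ _k : Fin 3, C * K * T := Finset.sum_le_sum fun k _ => hcomp k
    _ = 3 * (C * K) * T := by
        simp
        ring
    _ ≤ 3 * (C * K) * (2 * ((∫ y, W y * ‖z y‖ ^ 2) + ((∫ y, W y * ‖curl3 z y‖ ^ 2)
          + ∑ i, ∫ y, W y * ‖curl3 (pd i z) y‖ ^ 2))) := by
        refine mul_le_mul_of_nonneg_left ?_ (by positivity)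
        rw [hT]
        linarith
    _ = 6 * (C * K) * ((∫ y, W y * ‖z y‖ ^ 2) + ((∫ y, W y * ‖curl3 z y‖ ^ 2)
          + ∑ i, ∫ y, W y * ‖curl3 (pd i z) y‖ ^ 2)) := by ring
    _ ≤ _ := mul_le_mul_of_nonneg_right (by linarith) (by linarith)

end
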